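/- For any n ≥ 2 and any m ∈ ℕ, there exists a smooth irreducible hypersurface V ⊆ A^n of degree m such that deg(TV) = m²; hence the bound deg(TV) ≤ (deg(V))² for smooth irreducible hypersurfaces is optimal. -/

import Mathlib

open MvPolynomial

/-- A subset of affine space is an algebraic set if it is the zero locus of an
ideal of polynomials. -/
def IsAlgebraicSet {K : Type} [Field K] {n : ℕ} (W : Set (Fin n → K)) : Prop :=
  ∃ I : Ideal (MvPolynomial (Fin n) K), W = zeroLocus K I

/-- An irreducible affine variety: an algebraic set whose vanishing ideal is prime. -/
def IsIrreducibleVariety {K : Type} [Field K] {n : ℕ} (W : Set (Fin n → K)) : Prop :=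
  IsAlgebraicSet W ∧ (vanishingIdeal K W).IsPrime

/-- The dimension of an affine algebraic set: the Krull dimension of its coordinate ring. -/
noncomputable def varDim {K : Type} [Field K] {n : ℕ} (W : Set (Fin n → K)) : ℕ :=
  ENat.toNat ((ringKrullDim (MvPolynomial (Fin n) K ⧸ vanishingIdeal K W)).unbotD 0)

/-- The (Zariski) tangent space of `W` at `p`:
all `y` with `∇f(p)·y = 0` for every `f ∈ I(W)`. -/
def tangentSpaceAt {K : Type} [Field K] {n : ℕ} (W : Set (Fin n → K)) (p : Fin n → K) :
    Set (Fin n → K) :=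
  {y | ∀ f ∈ vanishingIdeal K W, ∑ i, eval p (pderiv i f) * y i = 0}

/-- The dimension of the tangent space at a point. -/
noncomputable def tangentDimAt {K : Type} [Field K] {n : ℕ} (W : Set (Fin n → K))
    (p : Fin n → K) : ℕ :=
  Module.finrank K (Submodule.span K (tangentSpaceAt W p))

/-- A point of an (irreducible) variety is a smooth point when the tangent space has
the dimension of the variety. -/
def IsSmoothAt {K : Type} [Field K] {n : ℕ} (W : Set (Fin n → K)) (p : Fin n → K) : Prop :=
  tangentDimAt W p = varDim W

/-- A variety is smooth if it is smooth at each of its points. -/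
def IsSmoothVariety {K : Type} [Field K] {n : ℕ} (W : Set (Fin n → K)) : Prop :=
  ∀ p ∈ W, IsSmoothAt W p

/-- Projection `A^{2n} → A^n` to the first `n` coordinates. -/
def fstProj {K : Type} {n : ℕ} (z : Fin (n + n) → K) : Fin n → K :=
  fun i => z (Fin.castAdd n i)

/-- Projection `A^{2n} → A^n` to the last `n` coordinates. -/
def sndProj {K : Type} {n : ℕ} (z : Fin (n + n) → K) : Fin n → K :=
  fun i => z (Fin.natAdd n i)

/-- The tangent bundle `TW ⊆ A^{2n}`: pairs `(x, y)` with `x ∈ W` and `y ∈ T_x W`. -/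
def tangentBundle {K : Type} [Field K] {n : ℕ} (W : Set (Fin n → K)) :
    Set (Fin (n + n) → K) :=
  {z | fstProj z ∈ W ∧ sndProj z ∈ tangentSpaceAt W (fstProj z)}

/-- Zariski closure of a subset of affine space. -/
def zclosure {K : Type} [Field K] {n : ℕ} (W : Set (Fin n → K)) : Set (Fin n → K) :=
  zeroLocus K (vanishingIdeal K W)

/-- The tangential variety `Tan(W)`: the Zariski closure of `π₂(TW)`. -/
def tangentialVariety {K : Type} [Field K] {n : ℕ} (W : Set (Fin n → K)) :
    Set (Fin n → K) :=
  zclosure (sndProj '' tangentBundle W)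

/-- The geometric degree of an (irreducible) affine algebraic set: the maximal finite
number of points in an intersection with an affine-linear subspace of complementary
dimension. -/
noncomputable def geomDegree {K : Type} [Field K] {n : ℕ} (W : Set (Fin n → K)) : ℕ :=
  sSup {m | ∃ L : AffineSubspace K (Fin n → K),
    Module.finrank K L.direction = n - varDim W ∧
    (W ∩ (L : Set (Fin n → K))).Finite ∧ (W ∩ (L : Set (Fin n → K))).ncard = m}

/-- A linear variety: an affine-linear subspace of affine space. -/
def IsLinearVariety {K : Type} [Field K] {n : ℕ} (W : Set (Fin n → K)) : Prop :=
  ∃ L : AffineSubspace K (Fin n → K), W = (L : Set (Fin n → K))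

/-- A line: an affine-linear subspace of dimension 1. -/
def IsLine {K : Type} [Field K] {n : ℕ} (W : Set (Fin n → K)) : Prop :=
  ∃ L : AffineSubspace K (Fin n → K), W = (L : Set (Fin n → K)) ∧
    Module.finrank K L.direction = 1

open Classical in
/-- `ω(C)`: the number of points in the fiber of `π₂ : TC → Tan(C)` over a generic
point of `Tan(C)`; it is `0` when `C` is a line. -/
noncomputable def omegaCurve {K : Type} [Field K] {n : ℕ} (C : Set (Fin n → K)) : ℕ :=
  if IsLine C then 0
  else sInf {m | ∃ Z : Set (Fin n → K), IsAlgebraicSet Z ∧ ¬ tangentialVariety C ⊆ Z ∧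
    ∀ v ∈ tangentialVariety C \ Z,
      {z ∈ tangentBundle C | sndProj z = v}.ncard = m}

/-- A smooth irreducible algebraic curve. -/
def IsSmoothCurve {K : Type} [Field K] {n : ℕ} (C : Set (Fin n → K)) : Prop :=
  IsIrreducibleVariety C ∧ varDim C = 1 ∧ IsSmoothVariety C

namespace FermatTB

/-- The Fermat polynomial. -/
noncomputable def fpoly (K : Type) [Field K] (k m : ℕ) : MvPolynomial (Fin (k + 2)) K :=
  X 0 ^ m + X 1 ^ m - 1

/-- The Fermat hypersurface. -/
def fset (K : Type) [Field K] (k m : ℕ) : Set (Fin (k + 2) → K) :=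
  {x | x 0 ^ m + x 1 ^ m = 1}

lemma fpoly_irreducible (K : Type) [Field K] [CharZero K] (k m : ℕ) (hm : 0 < m) :
    Irreducible (fpoly K k m) := by
  rw [← MulEquiv.irreducible_iff (finSuccEquiv K (k + 1))]
  set c : MvPolynomial (Fin (k + 1)) K := X 0 ^ m - 1 with hc
  have e : finSuccEquiv K (k + 1) (fpoly K k m) = Polynomial.X ^ m + Polynomial.C c := by
    have h1 : (1 : Fin (k + 2)) = Fin.succ 0 := rfl
    rw [fpoly, map_sub, map_add, map_pow, map_pow, finSuccEquiv_X_zero, h1, finSuccEquiv_X_succ]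
    simp [hc]
    ring
  rw [e]
  let P : Ideal (MvPolynomial (Fin (k + 1)) K) := RingHom.ker (eval (fun _ => (1 : K)))
  have hP : P.IsPrime := RingHom.ker_isPrime _
  have hmon := Polynomial.monic_X_pow_add_C c hm.ne'
  have hdeg := Polynomial.degree_X_pow_add_C hm c
  apply Polynomial.irreducible_of_eisenstein_criterion hP
  · rw [hmon.leadingCoeff]
    exact fun h => hP.ne_top ((Ideal.eq_top_iff_one _).2 h)
  · intro j hj
    rw [hdeg] at hj
    have hj' : j < m := by exact_mod_cast hj
    rw [Polynomial.coeff_add, Polynomial.coeff_X_pow, if_neg hj'.ne, zero_add, Polynomial.coeff_C]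
    split_ifs
    · simp [P, RingHom.mem_ker, hc]
    · exact P.zero_mem
  · rw [hdeg]; exact_mod_cast hm
  · rw [Polynomial.coeff_add, Polynomial.coeff_X_pow, if_neg hm.ne, zero_add,
      Polynomial.coeff_C_zero]
    intro h
    have key : ∀ q ∈ P ^ 2, eval (fun _ => (1 : K)) (pderiv 0 q) = 0 := by
      intro q hq
      rw [pow_two] at hq
      refine Submodule.mul_induction_on hq ?_ ?_
      · intro a ha b hb
        have ha' : eval (fun _ => (1 : K)) a = 0 := ha
        have hb' : eval (fun _ => (1 : K)) b = 0 := hb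
        simp [Derivation.leibniz, ha', hb']
      · intro a b ha hb
        simp [ha, hb]
    have := key c h
    simp [hc, Derivation.leibniz_pow] at this
    omega
  · exact hmon.isPrimitive

lemma fset_eq (K : Type) [Field K] (k m : ℕ) :
    fset K k m = zeroLocus K (Ideal.span {fpoly K k m}) := by
  rw [zeroLocus_span]
  ext x
  simp [fset, fpoly, sub_eq_zero]

lemma fspan_prime (K : Type) [Field K] [CharZero K] (k m : ℕ) (hm : 0 < m) :
    (Ideal.span {fpoly K k m}).IsPrime := by
  have := fpoly_irreducible K k m hm
  exact (Ideal.span_singleton_prime this.ne_zero).2 this.prime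

lemma vanishing_fset (K : Type) [Field K] [IsAlgClosed K] [CharZero K] (k m : ℕ) (hm : 0 < m) :
    vanishingIdeal K (fset K k m) = Ideal.span {fpoly K k m} := by
  rw [fset_eq, vanishingIdeal_zeroLocus_eq_radical, (fspan_prime K k m hm).radical]

lemma height_max (K : Type) [Field K] (n : ℕ) (P : Ideal (MvPolynomial (Fin n) K))
    [hP : P.IsMaximal] : P.height = n := by
  induction n with
  | zero =>
    have h := Ideal.height_le_ringKrullDim_of_ne_top hP.ne_top
    rw [MvPolynomial.ringKrullDim_of_isNoetherianRing, ringKrullDim_eq_zero_of_field] at h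
    simp at h
    simpa using h
  | succ n ih =>
    let e := (finSuccEquiv K n).toRingEquiv
    let Q := P.map e
    have hQ : Q.IsMaximal := Ideal.map_isMaximal_of_equiv e
    have h1 : Q.height = P.height := e.height_map P
    let p := Q.under (MvPolynomial (Fin n) K)
    have hp : p.IsMaximal := Polynomial.isMaximal_comap_C_of_isJacobsonRing Q
    have hlo : Q.LiesOver p := ⟨rfl⟩
    have := Polynomial.height_eq_height_add_one p Q
    rw [← h1, this, ih p]
    simp

lemma ringKrullDim_quot_fpoly (K : Type) [Field K] [CharZero K] (k m : ℕ) (hm : 0 < m) :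
    ringKrullDim (MvPolynomial (Fin (k + 2)) K ⧸ Ideal.span {fpoly K k m}) = (k + 1 : ℕ) := by
  have hirr := fpoly_irreducible K k m hm
  have hprime := fspan_prime K k m hm
  have hu := ringKrullDim_quotient_succ_le_of_nonZeroDivisor
    (mem_nonZeroDivisors_of_ne_zero hirr.ne_zero)
  rw [MvPolynomial.ringKrullDim_of_isNoetherianRing, ringKrullDim_eq_zero_of_field] at hu
  obtain ⟨P, hP, hle⟩ := Ideal.exists_le_maximal _ hprime.ne_top
  have hl := Ideal.height_le_ringKrullDim_quotient_add_one (p := P)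
    (hle (Ideal.mem_span_singleton_self _))
  rw [height_max] at hl
  have : Nontrivial (MvPolynomial (Fin (k + 2)) K ⧸ Ideal.span {fpoly K k m}) :=
    Ideal.Quotient.nontrivial_iff.2 hprime.ne_top
  have h0 := ringKrullDim_nonneg_of_nontrivial
    (R := MvPolynomial (Fin (k + 2)) K ⧸ Ideal.span {fpoly K k m})
  generalize ringKrullDim (MvPolynomial (Fin (k + 2)) K ⧸ Ideal.span {fpoly K k m}) = d at *
  simp only [Nat.card_eq_fintype_card, Fintype.card_fin, zero_add] at hu
  induction d using WithBot.recBotCoe with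
  | bot => simp at h0
  | coe d =>
    induction d using ENat.recTopCoe with
    | top => 
      rw [← WithBot.coe_one, ← WithBot.coe_add, top_add] at hu
      have hu' : (⊤ : ℕ∞) ≤ ((k + 2 : ℕ) : ℕ∞) := WithBot.coe_le_coe.1 hu
      exact absurd hu' (by simp)
    | coe d =>
      have hu1 : ((d + 1 : ℕ) : ℕ∞) ≤ ((k + 2 : ℕ) : ℕ∞) := WithBot.coe_le_coe.1 hu
      have hl1 : ((k + 2 : ℕ) : ℕ∞) ≤ ((d + 1 : ℕ) : ℕ∞) := WithBot.coe_le_coe.1 hl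
      have hu' : d + 1 ≤ k + 2 := by exact_mod_cast hu1
      have hl' : k + 2 ≤ d + 1 := by exact_mod_cast hl1
      have : d = k + 1 := by omega
      subst this
      rfl

lemma varDim_fset (K : Type) [Field K] [IsAlgClosed K] [CharZero K] (k m : ℕ) (hm : 0 < m) :
    varDim (fset K k m) = k + 1 := by
  rw [varDim, vanishing_fset K k m hm, ringKrullDim_quot_fpoly K k m hm]
  rfl

lemma ringKrullDim_le_of_maps {K : Type} [Field K] {a b : ℕ} (W : Set (Fin a → K))
    (W' : Set (Fin b → K)) (φ : Fin b → MvPolynomial (Fin a) K)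
    (ψ : Fin a → MvPolynomial (Fin b) K)
    (hφ : ∀ x ∈ W, (fun i => eval x (φ i)) ∈ W')
    (hψ : ∀ x ∈ W, (fun j => eval (fun i => eval x (φ i)) (ψ j)) = x) :
    ringKrullDim (MvPolynomial (Fin a) K ⧸ vanishingIdeal K W) ≤
      ringKrullDim (MvPolynomial (Fin b) K ⧸ vanishingIdeal K W') := by
  have hev : ∀ x (p : MvPolynomial (Fin b) K),
      eval x (aeval φ p) = eval (fun i => eval x (φ i)) p := by
    intro x p
    induction p using MvPolynomial.induction_on with
    | C c => simp
    | add p q hp hq => simp only [map_add, hp, hq]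
    | mul_X p i hp => simp only [map_mul, aeval_X, eval_X, hp]
  have hle : ∀ p ∈ vanishingIdeal K W',
      ((Ideal.Quotient.mk (vanishingIdeal K W)).comp (aeval φ : _ →ₐ[K] _).toRingHom) p = 0 := by
    intro p hp
    refine Ideal.Quotient.eq_zero_iff_mem.2 ?_
    intro x hx
    have h2 : eval (fun i => eval x (φ i)) p = 0 := hp _ (hφ x hx)
    exact (hev x p).trans h2
  apply ringKrullDim_le_of_surjective (Ideal.Quotient.lift _ _ hle)
  apply Ideal.Quotient.lift_surjective_of_surjective
  intro y
  obtain ⟨q, rfl⟩ := Ideal.Quotient.mk_surjective y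
  refine ⟨aeval ψ q, ?_⟩
  refine Ideal.Quotient.eq.2 ?_
  intro x hx
  have hev2 : ∀ z (p : MvPolynomial (Fin a) K),
      eval z (aeval ψ p) = eval (fun i => eval z (ψ i)) p := by
    intro x p
    induction p using MvPolynomial.induction_on with
    | C c => simp
    | add p q hp hq => simp only [map_add, hp, hq]
    | mul_X p i hp => simp only [map_mul, aeval_X, eval_X, hp]
  have h1 : eval x (aeval φ (aeval ψ q)) = eval x q := by
    rw [hev, hev2, hψ x hx]
  rw [map_sub]
  exact sub_eq_zero.2 h1

/-- description of the tangent space -/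
lemma mem_tangentSpaceAt {K : Type} [Field K] [IsAlgClosed K] [CharZero K] {k m : ℕ} (hm : 0 < m)
    {p : Fin (k + 2) → K} (hp : p ∈ fset K k m) (y : Fin (k + 2) → K) :
    y ∈ tangentSpaceAt (fset K k m) p ↔ p 0 ^ (m - 1) * y 0 + p 1 ^ (m - 1) * y 1 = 0 := by
  have hmK : (m : K) ≠ 0 := by exact_mod_cast hm.ne'
  have hF : eval p (fpoly K k m) = 0 := by
    have : p 0 ^ m + p 1 ^ m = 1 := hp
    simp [fpoly, this]
  have hG : ∑ i, eval p (pderiv i (fpoly K k m)) * y i =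
      m * (p 0 ^ (m - 1) * y 0 + p 1 ^ (m - 1) * y 1) := by
    rw [Fin.sum_univ_succ, Fin.sum_univ_succ, Finset.sum_eq_zero]
    · have h10 : (1 : Fin (k + 2)) ≠ 0 := by simp
      simp [fpoly, Derivation.leibniz_pow, pderiv_X]
      ring
    · intro i _
      have h0 : (0 : Fin (k + 2)) ≠ i.succ.succ := (Fin.succ_ne_zero _).symm
      have h1 : (1 : Fin (k + 2)) ≠ i.succ.succ := by
        intro h
        simp [Fin.ext_iff] at h
      simp [fpoly, Derivation.leibniz_pow, pderiv_X_of_ne h0, pderiv_X_of_ne h1]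
  constructor
  · intro h
    have := h (fpoly K k m) (by
      rw [vanishing_fset K k m hm]; exact Ideal.mem_span_singleton_self _)
    rw [hG] at this
    exact (mul_eq_zero.1 this).resolve_left hmK
  · intro h f hf
    rw [vanishing_fset K k m hm, Ideal.mem_span_singleton] at hf
    obtain ⟨g, rfl⟩ := hf
    have : ∀ i, eval p (pderiv i (fpoly K k m * g)) * y i =
        eval p g * (eval p (pderiv i (fpoly K k m)) * y i) := by
      intro i
      simp [Derivation.leibniz, hF]
      ring
    simp_rw [this]
    rw [← Finset.mul_sum, hG, h]
    simp

lemma coeff_ne {K : Type} [Field K] {k m : ℕ} (hm : 0 < m)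
    {p : Fin (k + 2) → K} (hp : p ∈ fset K k m) : p 0 ^ (m - 1) ≠ 0 ∨ p 1 ^ (m - 1) ≠ 0 := by
  by_contra! h
  have : p 0 ^ m + p 1 ^ m = 1 := hp
  obtain ⟨j, rfl⟩ : ∃ j, m = j + 1 := ⟨m - 1, by omega⟩
  simp only [Nat.add_sub_cancel] at h
  rw [pow_succ, pow_succ, h.1, h.2] at this
  simp at this

lemma fset_smooth (K : Type) [Field K] [IsAlgClosed K] [CharZero K] (k m : ℕ) (hm : 0 < m) :
    IsSmoothVariety (fset K k m) := by
  intro p hp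
  rw [IsSmoothAt, varDim_fset K k m hm, tangentDimAt]
  let l : (Fin (k + 2) → K) →ₗ[K] K :=
    p 0 ^ (m - 1) • LinearMap.proj 0 + p 1 ^ (m - 1) • LinearMap.proj 1
  have hl : l ≠ 0 := by
    intro h
    have h0 : l (Pi.single 0 1) = 0 := by rw [h]; rfl
    have h1 : l (Pi.single 1 1) = 0 := by rw [h]; rfl
    simp [l] at h0 h1
    rcases coeff_ne hm hp with h | h
    · exact h (by simpa using h0)
    · exact h (by simpa using h1)
  have : tangentSpaceAt (fset K k m) p = (LinearMap.ker l : Set (Fin (k + 2) → K)) := by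
    ext y
    rw [mem_tangentSpaceAt hm hp]
    simp [l]
  rw [this, Submodule.span_eq]
  have h := Module.Dual.finrank_ker_add_one_of_ne_zero (f := l) hl
  simp at h
  omega

lemma fset_irr (K : Type) [Field K] [IsAlgClosed K] [CharZero K] (k m : ℕ) (hm : 0 < m) :
    IsIrreducibleVariety (fset K k m) :=
  ⟨⟨_, fset_eq K k m⟩, by rw [vanishing_fset K k m hm]; exact fspan_prime K k m hm⟩

lemma mem_tb {K : Type} [Field K] [IsAlgClosed K] [CharZero K] {k m : ℕ} (hm : 0 < m)
    (z : Fin ((k + 2) + (k + 2)) → K) :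
    z ∈ tangentBundle (fset K k m) ↔
      z ⟨0, by omega⟩ ^ m + z ⟨1, by omega⟩ ^ m = 1 ∧
      z ⟨0, by omega⟩ ^ (m - 1) * z ⟨k + 2, by omega⟩ +
        z ⟨1, by omega⟩ ^ (m - 1) * z ⟨k + 3, by omega⟩ = 0 := by
  have h0 : fstProj z 0 = z ⟨0, by omega⟩ := rfl
  have h1 : fstProj z 1 = z ⟨1, by omega⟩ := rfl
  have h2 : sndProj z 0 = z ⟨k + 2, by omega⟩ := rfl
  have h3 : sndProj z 1 = z ⟨k + 3, by omega⟩ := rfl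
  rw [← h0, ← h1, ← h2, ← h3]
  constructor
  · rintro ⟨h, h'⟩
    exact ⟨h, (mem_tangentSpaceAt hm h _).1 h'⟩
  · rintro ⟨h, h'⟩
    exact ⟨h, (mem_tangentSpaceAt hm h _).2 h'⟩

noncomputable def phi (K : Type) [Field K] (k : ℕ) (i : Fin ((2 * k + 1) + 2)) :
    MvPolynomial (Fin ((k + 2) + (k + 2))) K :=
  if h : i.1 < k + 2 then X ⟨i.1, by omega⟩
  else if i.1 = k + 2 then
    X ⟨1, by omega⟩ * X ⟨k + 2, by omega⟩ - X ⟨0, by omega⟩ * X ⟨k + 3, by omega⟩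
  else X ⟨i.1 + 1, by omega⟩

noncomputable def psi (K : Type) [Field K] (k m : ℕ) (l : Fin ((k + 2) + (k + 2))) :
    MvPolynomial (Fin ((2 * k + 1) + 2)) K :=
  if h : l.1 < k + 2 then X ⟨l.1, by omega⟩
  else if l.1 = k + 2 then X ⟨1, by omega⟩ ^ (m - 1) * X ⟨k + 2, by omega⟩
  else if l.1 = k + 3 then - X ⟨0, by omega⟩ ^ (m - 1) * X ⟨k + 2, by omega⟩
  else X ⟨l.1 - 1, by omega⟩

lemma varDim_tb (K : Type) [Field K] [IsAlgClosed K] [CharZero K] (k m : ℕ) (hm : 0 < m) :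
    varDim (tangentBundle (fset K k m)) = 2 * k + 2 := by
  have key : ringKrullDim (MvPolynomial (Fin ((k + 2) + (k + 2))) K ⧸
      vanishingIdeal K (tangentBundle (fset K k m))) =
      ringKrullDim (MvPolynomial (Fin ((2 * k + 1) + 2)) K ⧸
      vanishingIdeal K (fset K (2 * k + 1) m)) := by
    obtain ⟨j, rfl⟩ : ∃ j, m = j + 1 := ⟨m - 1, by omega⟩
    apply le_antisymm
    · apply ringKrullDim_le_of_maps _ _ (phi K k) (psi K k (j + 1))
      · intro x hx
        rw [mem_tb hm] at hx
        have := hx.1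
        simpa [fset, phi] using this
      · intro x hx
        rw [mem_tb hm] at hx
        obtain ⟨h1, h2⟩ := hx
        simp only [Nat.add_sub_cancel] at h2
        funext l
        simp only [psi]
        split_ifs with ha hb hc
        · simp [phi, ha]
        · have : l = ⟨k + 2, by omega⟩ := Fin.ext hb
          rw [this]
          simp [phi, -Fin.zero_eta, -Fin.mk_one, -Fin.mk_zero']
          have z0 : x 0 = x ⟨0, by omega⟩ := rfl
          rw [z0]
          linear_combination x ⟨k + 2, by omega⟩ * h1 - x ⟨0, by omega⟩ * h2
        · have : l = ⟨k + 3, by omega⟩ := Fin.ext hc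
          rw [this]
          simp [phi, -Fin.zero_eta, -Fin.mk_one, -Fin.mk_zero']
          have z0 : x 0 = x ⟨0, by omega⟩ := rfl
          rw [z0]
          linear_combination x ⟨k + 3, by omega⟩ * h1 - x ⟨1, by omega⟩ * h2
        · have e1 : ¬ (l.1 - 1 < k + 2) := by omega
          have e2 : ¬ (l.1 - 1 = k + 2) := by omega
          simp only [eval_X, phi, dif_neg e1, if_neg e2]
          congr 1
          apply Fin.ext
          simp
          omega
    · apply ringKrullDim_le_of_maps _ _ (psi K k (j + 1)) (phi K k)
      · intro x hx
        have hx' : x 0 ^ (j + 1) + x 1 ^ (j + 1) = 1 := hx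
        rw [mem_tb hm]
        refine ⟨by simpa [psi] using hx', ?_⟩
        simp [psi]
        ring
      · intro x hx
        have hx' : x ⟨0, by omega⟩ ^ (j + 1) + x ⟨1, by omega⟩ ^ (j + 1) = 1 := hx
        funext i
        simp only [phi]
        split_ifs with ha hb
        · simp [psi, ha]
        · have : i = ⟨k + 2, by omega⟩ := Fin.ext hb
          rw [this]
          simp [psi, -Fin.zero_eta, -Fin.mk_one, -Fin.mk_zero']
          have z0 : x 0 = x ⟨0, by omega⟩ := rfl
          rw [z0]
          linear_combination x ⟨k + 2, by omega⟩ * hx'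
        · have e1 : ¬ (i.1 + 1 < k + 2) := by omega
          have e2 : ¬ (i.1 + 1 = k + 2) := by omega
          have e3 : ¬ (i.1 + 1 = k + 3) := by omega
          simp only [eval_X, psi, dif_neg e1, if_neg e2, if_neg e3]
          congr 1
  have h := varDim_fset K (2 * k + 1) m hm
  rw [varDim, key]
  exact h

/-- number of `m`-th roots -/
lemma ncard_roots (K : Type) [Field K] [IsAlgClosed K] [CharZero K] {m : ℕ} (hm : 0 < m)
    {c : K} (hc : c ≠ 0) : {x : K | x ^ m = c}.ncard = m ∧ {x : K | x ^ m = c}.Finite := by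
  classical
  have hmK : (m : K) ≠ 0 := by exact_mod_cast hm.ne'
  have hsep : (Polynomial.X ^ m - Polynomial.C c : Polynomial K).Separable :=
    Polynomial.separable_X_pow_sub_C c hmK hc
  have hne := Polynomial.X_pow_sub_C_ne_zero hm c
  have hset : {x : K | x ^ m = c} =
      ((Polynomial.X ^ m - Polynomial.C c : Polynomial K).roots.toFinset : Set K) := by
    ext x
    simp [hne, sub_eq_zero]
  have hcard := (IsAlgClosed.splits (Polynomial.X ^ m - Polynomial.C c : Polynomial K)).natDegree_eq_card_roots
  rw [hset]
  refine ⟨?_, Finset.finite_toSet _⟩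
  rw [Set.ncard_coe_finset, Multiset.toFinset_card_of_nodup (Polynomial.nodup_roots hsep), ← hcard,
    Polynomial.natDegree_X_pow_sub_C]

lemma geomDegree_eq {K : Type} [Field K] {n : ℕ} (W : Set (Fin n → K)) (d r : ℕ)
    (hd : n - varDim W = r)
    (hle : ∀ L : AffineSubspace K (Fin n → K), Module.finrank K L.direction = r →
      (W ∩ (L : Set (Fin n → K))).Finite → (W ∩ (L : Set (Fin n → K))).ncard ≤ d)
    (hex : ∃ L : AffineSubspace K (Fin n → K), Module.finrank K L.direction = r ∧
      (W ∩ (L : Set (Fin n → K))).Finite ∧ (W ∩ (L : Set (Fin n → K))).ncard = d) :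
    geomDegree W = d := by
  rw [geomDegree, hd]
  apply IsGreatest.csSup_eq
  refine ⟨hex, ?_⟩
  rintro _ ⟨L, h1, h2, rfl⟩
  exact hle L h1 h2

lemma geomDegree_fset (K : Type) [Field K] [IsAlgClosed K] [CharZero K] (k m : ℕ) (hm : 0 < m) :
    geomDegree (fset K k m) = m := by
  classical
  apply geomDegree_eq _ m 1 (by rw [varDim_fset K k m hm]; omega)
  · intro L hL hfin
    obtain ⟨⟨w, hwL⟩, hw0, hw⟩ := finrank_eq_one_iff'.1 hL
    have hw0' : w ≠ 0 := fun h => hw0 (Subtype.ext h)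
    rcases Set.eq_empty_or_nonempty (fset K k m ∩ (L : Set (Fin (k + 2) → K))) with he | ⟨p, hpV, hpL⟩
    · rw [he]; simp
    let a : Polynomial K := (Polynomial.C (p 0) + Polynomial.C (w 0) * Polynomial.X) ^ m +
      (Polynomial.C (p 1) + Polynomial.C (w 1) * Polynomial.X) ^ m - 1
    have hdeg : a.natDegree ≤ m := by
      simp only [a]
      compute_degree
    let γ : K → (Fin (k + 2) → K) := fun t => p + t • w
    have hγ : Function.Injective γ := by
      intro s t h
      have h' : s • w = t • w := add_left_cancel h
      exact smul_left_injective K hw0' h'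
    have hset : fset K k m ∩ (L : Set (Fin (k + 2) → K)) = γ '' {t | a.eval t = 0} := by
      ext z
      constructor
      · rintro ⟨hz, hzL⟩
        obtain ⟨t, ht⟩ := hw ⟨z - p, AffineSubspace.vsub_mem_direction hzL hpL⟩
        have ht' : t • w = z - p := congrArg Subtype.val ht
        have hz' : z = γ t := by simp [γ, ht']
        refine ⟨t, ?_, hz'.symm⟩
        have h2 : z 0 ^ m + z 1 ^ m = 1 := hz
        rw [hz'] at h2
        simp [γ] at h2
        change a.eval t = 0
        simp [a]
        linear_combination h2
      · rintro ⟨t, ht, rfl⟩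
        constructor
        · have ht' : a.eval t = 0 := ht
          simp [a] at ht'
          simp [fset, γ]
          linear_combination ht'
        · have := AffineSubspace.vadd_mem_of_mem_direction (L.direction.smul_mem t hwL) hpL
          simpa [γ, add_comm] using this
    rw [hset] at hfin ⊢
    rw [Set.ncard_image_of_injective _ hγ]
    have hfin' : {t | a.eval t = 0}.Finite := hfin.of_finite_image hγ.injOn
    have ha : a ≠ 0 := by
      intro h
      rw [h] at hfin'
      simp at hfin'
      exact Set.infinite_univ hfin'
    have : {t | a.eval t = 0} = (a.roots.toFinset : Set K) := by
      ext t; simp [ha]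
    rw [this, Set.ncard_coe_finset]
    exact (Multiset.toFinset_card_le _).trans ((Polynomial.card_roots' a).trans hdeg)
  · let e : Fin (k + 2) → K := Pi.single 0 1
    have he0 : e ≠ 0 := by simp [e]
    refine ⟨(Submodule.span K {e}).toAffineSubspace, ?_, ?_⟩
    · rw [Submodule.toAffineSubspace_direction]
      exact finrank_span_singleton he0
    have hset : fset K k m ∩ ((Submodule.span K {e}).toAffineSubspace : Set (Fin (k + 2) → K)) =
        (fun t : K => t • e) '' {t : K | t ^ m = 1} := by
      ext z
      constructor
      · rintro ⟨hz, hzL⟩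
        have : z ∈ Submodule.span K {e} := hzL
        obtain ⟨t, rfl⟩ := Submodule.mem_span_singleton.1 this
        refine ⟨t, ?_, rfl⟩
        simpa [fset, e, hm.ne'] using hz
      · rintro ⟨t, ht, rfl⟩
        have ht' : t ^ m = 1 := ht
        refine ⟨by simpa [fset, e, hm.ne'] using ht', ?_⟩
        exact Submodule.mem_span_singleton.2 ⟨t, rfl⟩
    obtain ⟨h1, h2⟩ := ncard_roots K hm (one_ne_zero (α := K))
    rw [hset]
    refine ⟨h2.image _, ?_⟩
    rw [Set.ncard_image_of_injective _ (smul_left_injective K he0), h1]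

/-- The image of polynomials of bounded degree in the coordinate ring of the Fermat curve. -/
noncomputable def filt (K : Type) [Field K] (m d : ℕ) :
    Submodule K (MvPolynomial (Fin 2) K ⧸ vanishingIdeal K (fset K 0 m)) :=
  (restrictTotalDegree (Fin 2) K d).map (Ideal.Quotient.mkₐ K _).toLinearMap

instance (K : Type) [Field K] (m d : ℕ) : Module.Finite K (filt K m d) := by
  unfold filt
  infer_instance

lemma deg_mono_le (K : Type) [Field K] (a b : ℕ) :
    (X 0 ^ a * X 1 ^ b : MvPolynomial (Fin 2) K).totalDegree ≤ a + b := by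
  refine (totalDegree_mul _ _).trans ?_
  simp [totalDegree_X_pow]

lemma filt_succ (K : Type) [Field K] [IsAlgClosed K] [CharZero K] (m d : ℕ) (hm : 0 < m) :
    filt K m (d + 1) ≤ filt K m d ⊔ Submodule.span K (Set.range (fun i : Fin m =>
      (Ideal.Quotient.mkₐ K (vanishingIdeal K (fset K 0 m))
        (X 0 ^ (i : ℕ) * X 1 ^ (d + 1 - (i : ℕ)))))) := by
  set T := filt K m d ⊔ Submodule.span K (Set.range (fun i : Fin m =>
      (Ideal.Quotient.mkₐ K (vanishingIdeal K (fset K 0 m))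
        (X 0 ^ (i : ℕ) * X 1 ^ (d + 1 - (i : ℕ)))))) with hT
  have mono : ∀ a b : ℕ, a + b ≤ d + 1 →
      Ideal.Quotient.mkₐ K (vanishingIdeal K (fset K 0 m)) (X 0 ^ a * X 1 ^ b) ∈ T := by
    intro a
    induction a using Nat.strong_induction_on with
    | _ a ih =>
      intro b hab
      by_cases h1 : a + b ≤ d
      · apply Submodule.mem_sup_left
        exact ⟨_, (mem_restrictTotalDegree _ _ _).2 ((deg_mono_le K a b).trans h1), rfl⟩
      · by_cases h2 : a < m
        · apply Submodule.mem_sup_right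
          apply Submodule.subset_span
          refine ⟨⟨a, h2⟩, ?_⟩
          have : d + 1 - a = b := by omega
          simp [this]
        · obtain ⟨c, rfl⟩ : ∃ c, a = c + m := ⟨a - m, by omega⟩
          have e : Ideal.Quotient.mkₐ K (vanishingIdeal K (fset K 0 m)) (X 0 ^ (c + m) * X 1 ^ b) =
              Ideal.Quotient.mkₐ K (vanishingIdeal K (fset K 0 m)) (X 0 ^ c * X 1 ^ b) -
              Ideal.Quotient.mkₐ K (vanishingIdeal K (fset K 0 m)) (X 0 ^ c * X 1 ^ (b + m)) := by
            rw [← map_sub]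
            refine Ideal.Quotient.eq.2 ?_
            intro x hx
            have hx' : x 0 ^ m + x 1 ^ m = 1 := hx
            simp
            linear_combination x 0 ^ c * x 1 ^ b * hx'
          rw [e]
          apply T.sub_mem
          · apply Submodule.mem_sup_left
            exact ⟨_, (mem_restrictTotalDegree _ _ _).2 ((deg_mono_le K c b).trans (by omega)), rfl⟩
          · exact ih c (by omega) (b + m) (by omega)
  rintro _ ⟨p, hp, rfl⟩
  have hp' := (mem_restrictTotalDegree _ _ _).1 hp
  rw [p.as_sum, map_sum]
  apply T.sum_mem
  intro s hs
  have hs' : s 0 + s 1 ≤ d + 1 := by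
    refine le_trans ?_ ((le_totalDegree hs).trans hp')
    rw [Finsupp.sum_fintype _ _ (fun _ => rfl), Fin.sum_univ_two]
  have : monomial s (coeff s p) = coeff s p • (X 0 ^ s 0 * X 1 ^ s 1 : MvPolynomial (Fin 2) K) := by
    rw [monomial_eq, Finsupp.prod_fintype _ _ (fun _ => pow_zero _), Fin.prod_univ_two, smul_eq_C_mul]
  rw [this, map_smul]
  exact T.smul_mem _ (mono _ _ hs')

lemma finrank_filt_succ (K : Type) [Field K] [IsAlgClosed K] [CharZero K] (m d : ℕ) (hm : 0 < m) :
    Module.finrank K (filt K m (d + 1)) ≤ Module.finrank K (filt K m d) + m := by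
  have hfd : Module.Finite K (Submodule.span K (Set.range (fun i : Fin m =>
      (Ideal.Quotient.mkₐ K (vanishingIdeal K (fset K 0 m))
        (X 0 ^ (i : ℕ) * X 1 ^ (d + 1 - (i : ℕ))))))) :=
    FiniteDimensional.span_of_finite K (Set.finite_range _)
  refine (Submodule.finrank_mono (filt_succ K m d hm)).trans ?_
  refine (Submodule.finrank_add_le_finrank_add_finrank _ _).trans ?_
  gcongr
  refine (finrank_range_le_card _).trans ?_
  simp

lemma finrank_filt_add (K : Type) [Field K] [IsAlgClosed K] [CharZero K] (m d r : ℕ) (hm : 0 < m) :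
    Module.finrank K (filt K m (d + r)) ≤ Module.finrank K (filt K m d) + r * m := by
  induction r with
  | zero => simp
  | succ r ih =>
    have := finrank_filt_succ K m (d + r) hm
    rw [← add_assoc]
    rw [Nat.add_mul]
    omega

lemma fset_infinite (K : Type) [Field K] [IsAlgClosed K] [CharZero K] (k m : ℕ) (hm : 0 < m) :
    (fset K k m).Infinite := by
  intro hfin
  have : Set.SurjOn (fun x : Fin (k + 2) → K => x 1) (fset K k m) Set.univ := by
    intro t _
    obtain ⟨s, hs⟩ := IsAlgClosed.exists_pow_nat_eq (1 - t ^ m) hm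
    refine ⟨fun i => if i = 0 then s else t, ?_, ?_⟩
    · simp [fset, hs]
    · simp
  exact Set.infinite_univ (hfin.of_surjOn _ this)

lemma exists_interp {K : Type} [Field K] {σ : Type} (S : Finset (σ → K)) (p : σ → K) :
    ∃ e : MvPolynomial σ K, eval p e = 1 ∧ ∀ q ∈ S, q ≠ p → eval q e = 0 := by
  classical
  have h : ∀ q : σ → K, ∃ e : MvPolynomial σ K, eval p e = 1 ∧ (q ≠ p → eval q e = 0) := by
    intro q
    by_cases hq : q = p
    · exact ⟨1, by simp, fun h => absurd hq h⟩
    · obtain ⟨i, hi⟩ := Function.ne_iff.1 hq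
      have hi' : p i - q i ≠ 0 := sub_ne_zero.2 (Ne.symm hi)
      refine ⟨C (p i - q i)⁻¹ * (X i - C (q i)), ?_, ?_⟩
      · simp [hi']
      · intro _; simp
  choose e he1 he2 using h
  refine ⟨∏ q ∈ S, e q, ?_, ?_⟩
  · rw [map_prod]; exact Finset.prod_eq_one fun q _ => he1 q
  · intro q hq hne
    rw [map_prod]
    exact Finset.prod_eq_zero hq (he2 q hne)

lemma bezout (K : Type) [Field K] [IsAlgClosed K] [CharZero K] (m : ℕ) (hm : 0 < m)
    (g : MvPolynomial (Fin 2) K) (hg : g.totalDegree ≤ m)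
    (hfin : (fset K 0 m ∩ {x | eval x g = 0}).Finite) :
    (fset K 0 m ∩ {x | eval x g = 0}).ncard ≤ m ^ 2 := by
  classical
  set I := vanishingIdeal K (fset K 0 m) with hI
  have hprime : I.IsPrime := (fset_irr K 0 m hm).2
  have hgI : g ∉ I := by
    intro h
    apply fset_infinite K 0 m hm
    refine hfin.subset ?_
    intro x hx
    exact ⟨hx, h x hx⟩
  set S := hfin.toFinset with hS
  have hSmem : ∀ x, x ∈ S ↔ x ∈ fset K 0 m ∧ eval x g = 0 := by
    intro x; simp [hS]
  rw [Set.ncard_eq_toFinset_card _ hfin]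
  choose e he1 he2 using fun p : Fin 2 → K => exists_interp S p
  let D := S.sup (fun p => (e p).totalDegree)
  let evR : MvPolynomial (Fin 2) K →ₐ[K] (S → K) := AlgHom.pi (fun s => aeval s.1)
  have hev : ∀ a ∈ I, evR a = 0 := by
    intro a ha
    funext s
    exact ha s.1 ((hSmem _).1 s.2).1
  let ev : (MvPolynomial (Fin 2) K ⧸ I) →ₐ[K] (S → K) := Ideal.Quotient.liftₐ I evR hev
  have hevmk : ∀ (a : MvPolynomial (Fin 2) K) (s : S),
      ev (Ideal.Quotient.mkₐ K I a) s = eval s.1 a := by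
    intro a s
    rfl
  let A := filt K m (D + m)
  let f : A →ₗ[K] (S → K) := ev.toLinearMap.domRestrict A
  have hsurj : LinearMap.range f = ⊤ := by
    rw [eq_top_iff]
    intro v _
    rw [← Finset.univ_sum_single v]
    apply Submodule.sum_mem
    intro s _
    have hmem : Ideal.Quotient.mkₐ K I (e s.1) ∈ A := by
      refine ⟨e s.1, (mem_restrictTotalDegree _ _ _).2 ?_, rfl⟩
      exact (Finset.le_sup (f := fun p => (e p).totalDegree) s.2).trans (Nat.le_add_right _ _)
    refine ⟨v s • ⟨_, hmem⟩, ?_⟩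
    funext t
    have h1 : f (v s • ⟨_, hmem⟩) t = v s * eval t.1 (e s.1) := by
      rw [map_smul]
      rfl
    rw [h1]
    by_cases hts : t = s
    · subst hts
      simp [he1]
    · rw [he2 s.1 t.1 t.2 (fun h => hts (Subtype.ext h))]
      simp [hts]
  let mg : (MvPolynomial (Fin 2) K ⧸ I) →ₗ[K] (MvPolynomial (Fin 2) K ⧸ I) :=
    LinearMap.mulLeft K (Ideal.Quotient.mkₐ K I g)
  have hmg : Function.Injective mg := by
    have hne : Ideal.Quotient.mkₐ K I g ≠ 0 := fun h => hgI (Ideal.Quotient.eq_zero_iff_mem.1 h)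
    intro a b hab
    have : IsDomain (MvPolynomial (Fin 2) K ⧸ I) := Ideal.Quotient.isDomain I
    exact mul_left_cancel₀ hne hab
  let N := (filt K m D).map mg
  have hNA : N ≤ A := by
    rintro _ ⟨_, ⟨p, hp, rfl⟩, rfl⟩
    refine ⟨g * p, (mem_restrictTotalDegree _ _ _).2 ?_, rfl⟩
    have := (mem_restrictTotalDegree _ _ _).1 hp
    exact (totalDegree_mul _ _).trans (by omega)
  have hNker : N.comap A.subtype ≤ LinearMap.ker f := by
    rintro ⟨a, haA⟩ ⟨_, ⟨p, hp, rfl⟩, ha⟩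
    rw [LinearMap.mem_ker]
    funext s
    have h1 : a = Ideal.Quotient.mkₐ K I (g * p) := ha.symm
    subst h1
    change ev (Ideal.Quotient.mkₐ K I (g * p)) s = 0
    rw [hevmk, map_mul, ((hSmem _).1 s.2).2, zero_mul]
  have hN1 : Module.finrank K N = Module.finrank K (filt K m D) :=
    (Submodule.equivMapOfInjective mg hmg _).finrank_eq.symm
  have hN2 : Module.finrank K (N.comap A.subtype) = Module.finrank K N :=
    (Submodule.comapSubtypeEquivOfLe hNA).finrank_eq
  have hrn := LinearMap.finrank_range_add_finrank_ker f
  rw [hsurj, finrank_top, Module.finrank_fintype_fun_eq_card, Fintype.card_coe] at hrn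
  have hk := Submodule.finrank_mono hNker
  have hA : Module.finrank K A ≤ Module.finrank K (filt K m D) + m * m :=
    finrank_filt_add K m D m hm
  rw [pow_two]
  change S.card ≤ _
  omega

lemma strip_bound {K : Type} [Field K] [CharZero K] {m : ℕ} (a b c : Polynomial K)
    (ha : a.natDegree ≤ m)
    (hfin : {x : K × K | a.eval x.1 = 0 ∧ c.eval x.1 + x.2 * b.eval x.1 = 0}.Finite) :
    {x : K × K | a.eval x.1 = 0 ∧ c.eval x.1 + x.2 * b.eval x.1 = 0}.ncard ≤ m := by
  classical
  set S := {x : K × K | a.eval x.1 = 0 ∧ c.eval x.1 + x.2 * b.eval x.1 = 0} with hS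
  have hb : ∀ x ∈ S, b.eval x.1 ≠ 0 := by
    rintro ⟨s, t⟩ ⟨h1, h2⟩ h3
    simp only at h1 h2 h3
    rw [h3, mul_zero, add_zero] at h2
    have : Function.Injective (fun t : K => (s, t)) := fun _ _ h => congrArg Prod.snd h
    refine Set.infinite_range_of_injective this (hfin.subset ?_)
    rintro _ ⟨t, rfl⟩
    simp [hS, h1, h2, h3]
  have hinj : Set.InjOn Prod.fst S := by
    rintro ⟨s, t⟩ h ⟨s', t'⟩ h' he
    simp only at he
    subst he
    have h3 := hb _ h
    simp only at h3
    have h4 := h.2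
    have h5 := h'.2
    simp only at h4 h5
    have : t * b.eval s = t' * b.eval s := by linear_combination h4 - h5
    rw [mul_right_cancel₀ h3 this]
  by_cases ha0 : a = 0
  · rcases Set.eq_empty_or_nonempty S with he | ⟨x, hx⟩
    · rw [he]; simp
    · exfalso
      have hb0 : b ≠ 0 := by
        rintro rfl
        exact hb x hx (by simp)
      have hinf : {s : K | b.eval s ≠ 0}.Infinite := by
        have h1 : {s : K | b.eval s = 0}.Finite := by
          refine (b.roots.toFinset.finite_toSet).subset ?_
          intro s hs
          simpa [hb0] using hs
        exact h1.infinite_compl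
      refine hinf (((hfin.image Prod.fst)).subset ?_)
      intro s hs
      have hs' : b.eval s ≠ 0 := hs
      refine ⟨(s, - c.eval s / b.eval s), ?_, rfl⟩
      simp [hS, ha0, hs']
  · rw [← hinj.ncard_image]
    have hsub : Prod.fst '' S ⊆ (a.roots.toFinset : Set K) := by
      rintro _ ⟨x, hx, rfl⟩
      have := hx.1
      simp [ha0, this]
    refine (Set.ncard_le_ncard hsub (Finset.finite_toSet _)).trans ?_
    rw [Set.ncard_coe_finset]
    exact (Multiset.toFinset_card_le _).trans ((Polynomial.card_roots' a).trans ha)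

lemma tb_bound (K : Type) [Field K] [IsAlgClosed K] [CharZero K] (k m : ℕ) (hm : 0 < m)
    (L : AffineSubspace K (Fin ((k + 2) + (k + 2)) → K))
    (hL : Module.finrank K L.direction = 2)
    (hfin : (tangentBundle (fset K k m) ∩ (L : Set (Fin ((k + 2) + (k + 2)) → K))).Finite) :
    (tangentBundle (fset K k m) ∩ (L : Set (Fin ((k + 2) + (k + 2)) → K))).ncard ≤ m ^ 2 := by
  classical
  obtain ⟨i0, hi0⟩ : ∃ i : Fin ((k + 2) + (k + 2)), i = ⟨0, by omega⟩ := ⟨_, rfl⟩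
  obtain ⟨i1, hi1⟩ : ∃ i : Fin ((k + 2) + (k + 2)), i = ⟨1, by omega⟩ := ⟨_, rfl⟩
  obtain ⟨i2, hi2⟩ : ∃ i : Fin ((k + 2) + (k + 2)), i = ⟨k + 2, by omega⟩ := ⟨_, rfl⟩
  obtain ⟨i3, hi3⟩ : ∃ i : Fin ((k + 2) + (k + 2)), i = ⟨k + 3, by omega⟩ := ⟨_, rfl⟩
  have hmem : ∀ z : Fin ((k + 2) + (k + 2)) → K, z ∈ tangentBundle (fset K k m) ↔
      z i0 ^ m + z i1 ^ m = 1 ∧ z i0 ^ (m - 1) * z i2 + z i1 ^ (m - 1) * z i3 = 0 := by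
    intro z
    rw [mem_tb hm, hi0, hi1, hi2, hi3]
  clear hi0 hi1 hi2 hi3
  rcases Set.eq_empty_or_nonempty
    (tangentBundle (fset K k m) ∩ (L : Set (Fin ((k + 2) + (k + 2)) → K))) with he | ⟨p, _, hpL⟩
  · rw [he]; simp
  by_cases hinj : ∀ w ∈ L.direction, w i0 = 0 → w i1 = 0 → w = 0
  · -- the base coordinates parametrize the plane
    let π : L.direction →ₗ[K] (Fin 2 → K) :=
      (LinearMap.pi ![LinearMap.proj i0, LinearMap.proj i1]).comp L.direction.subtype
    have hπ0 : ∀ v, π v 0 = v.1 i0 := fun v => rfl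
    have hπ1 : ∀ v, π v 1 = v.1 i1 := fun v => rfl
    have hπ : Function.Injective π := by
      rw [injective_iff_map_eq_zero]
      intro v hv
      apply Subtype.ext
      exact hinj v.1 v.2 (by rw [← hπ0, hv]; rfl) (by rw [← hπ1, hv]; rfl)
    have hsurj : Function.Surjective π :=
      (LinearMap.injective_iff_surjective_of_finrank_eq_finrank (by simp [hL])).1 hπ
    obtain ⟨u, hu⟩ := hsurj ![1, 0]
    obtain ⟨v, hv⟩ := hsurj ![0, 1]
    have hu0 : u.1 i0 = 1 := by rw [← hπ0, hu]; rfl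
    have hu1 : u.1 i1 = 0 := by rw [← hπ1, hu]; rfl
    have hv0 : v.1 i0 = 0 := by rw [← hπ0, hv]; rfl
    have hv1 : v.1 i1 = 1 := by rw [← hπ1, hv]; rfl
    let lin : Fin ((k + 2) + (k + 2)) → MvPolynomial (Fin 2) K := fun j =>
      C (p j) + (C (u.1 j) * (X 0 - C (p i0)) + C (v.1 j) * (X 1 - C (p i1)))
    have hlin : ∀ j, (lin j).totalDegree ≤ 1 := by
      intro j
      refine (totalDegree_add _ _).trans (max_le (by simp) ?_)
      refine (totalDegree_add _ _).trans (max_le ?_ ?_)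
      · refine (totalDegree_mul _ _).trans ?_
        rw [totalDegree_C, zero_add]
        refine (totalDegree_sub_C_le _ _).trans ?_
        simp
      · refine (totalDegree_mul _ _).trans ?_
        rw [totalDegree_C, zero_add]
        refine (totalDegree_sub_C_le _ _).trans ?_
        simp
    let g : MvPolynomial (Fin 2) K := X 0 ^ (m - 1) * lin i2 + X 1 ^ (m - 1) * lin i3
    have hg : g.totalDegree ≤ m := by
      refine (totalDegree_add _ _).trans (max_le ?_ ?_)
      · refine (totalDegree_mul _ _).trans ?_
        have := hlin i2
        rw [totalDegree_X_pow]
        omega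
      · refine (totalDegree_mul _ _).trans ?_
        have := hlin i3
        rw [totalDegree_X_pow]
        omega
    let Γ : (Fin 2 → K) → (Fin ((k + 2) + (k + 2)) → K) := fun q j => eval q (lin j)
    have hΓ0 : ∀ q, Γ q i0 = q 0 := by
      intro q; simp [Γ, lin, hu0, hv0]
    have hΓ1 : ∀ q, Γ q i1 = q 1 := by
      intro q; simp [Γ, lin, hu1, hv1]
    have hΓp : ∀ q, Γ q = (((q 0 - p i0) • u + (q 1 - p i1) • v : L.direction) :
        Fin ((k + 2) + (k + 2)) → K) + p := by
      intro q
      funext j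
      simp [Γ, lin]
      ring
    have hΓL : ∀ q, Γ q ∈ L := by
      intro q
      rw [hΓp]
      exact AffineSubspace.vadd_mem_of_mem_direction (Subtype.property _) hpL
    have hΓinj : Function.Injective Γ := by
      intro q q' h
      funext i
      fin_cases i
      · have := congrFun h i0
        rwa [hΓ0, hΓ0] at this
      · have := congrFun h i1
        rwa [hΓ1, hΓ1] at this
    have hset : tangentBundle (fset K k m) ∩ (L : Set (Fin ((k + 2) + (k + 2)) → K)) =
        Γ '' (fset K 0 m ∩ {x | eval x g = 0}) := by
      ext z
      constructor
      · rintro ⟨hz, hzL⟩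
        have hz' : Γ ![z i0, z i1] = z := by
          have h1 : Γ ![z i0, z i1] - z ∈ L.direction :=
            AffineSubspace.vsub_mem_direction (hΓL _) hzL
          have := hinj _ h1 (by simp [hΓ0]) (by simp [hΓ1])
          exact sub_eq_zero.1 this
        refine ⟨![z i0, z i1], ⟨?_, ?_⟩, hz'⟩
        · exact ((hmem z).1 hz).1
        · have h2 := ((hmem z).1 hz).2
          have e2 : eval ![z i0, z i1] (lin i2) = z i2 := congrFun hz' i2
          have e3 : eval ![z i0, z i1] (lin i3) = z i3 := congrFun hz' i3
          simp [g, e2, e3, h2]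
      · rintro ⟨q, ⟨hq1, hq2⟩, rfl⟩
        refine ⟨(hmem _).2 ?_, hΓL q⟩
        rw [hΓ0, hΓ1]
        refine ⟨hq1, ?_⟩
        have hq3 : eval q g = 0 := hq2
        simpa [g] using hq3
    rw [hset] at hfin ⊢
    rw [Set.ncard_image_of_injective _ hΓinj]
    exact bezout K m hm g hg (hfin.of_finite_image hΓinj.injOn)
  · push Not at hinj
    obtain ⟨w, hwL, hw0, hw1, hw⟩ := hinj
    have hw' : (⟨w, hwL⟩ : L.direction) ≠ 0 := fun h => hw (congrArg Subtype.val h)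
    obtain ⟨⟨v, hvL⟩, hli⟩ := exists_linearIndependent_pair_of_one_lt_finrank
      (R := K) (M := L.direction) (by omega) hw'
    have hspan := hli.span_eq_top_of_card_eq_finrank (by simp [hL])
    have hpair := LinearIndependent.pair_iff.1 hli
    let A : Polynomial K := Polynomial.C (p i0) + Polynomial.C (v i0) * Polynomial.X
    let B : Polynomial K := Polynomial.C (p i1) + Polynomial.C (v i1) * Polynomial.X
    let a : Polynomial K := A ^ m + B ^ m - 1
    let b : Polynomial K := A ^ (m - 1) * Polynomial.C (w i2) + B ^ (m - 1) * Polynomial.C (w i3)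
    let c : Polynomial K :=
      A ^ (m - 1) * (Polynomial.C (p i2) + Polynomial.C (v i2) * Polynomial.X) +
      B ^ (m - 1) * (Polynomial.C (p i3) + Polynomial.C (v i3) * Polynomial.X)
    have hdeg : a.natDegree ≤ m := by
      simp only [a, A, B]
      compute_degree
    let Γ : K × K → (Fin ((k + 2) + (k + 2)) → K) := fun x => (x.1 • v + x.2 • w) + p
    have hΓinj : Function.Injective Γ := by
      rintro ⟨s, t⟩ ⟨s', t'⟩ h
      have h1 : s • v + t • w = s' • v + t' • w := add_right_cancel h
      have h2 := hpair (t - t') (s - s') (by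
        apply Subtype.ext
        change (t - t') • w + (s - s') • v = 0
        have : s • v + t • w - (s' • v + t' • w) = 0 := sub_eq_zero.2 h1
        rw [sub_smul, sub_smul, ← this]
        abel)
      exact Prod.ext (sub_eq_zero.1 h2.2) (sub_eq_zero.1 h2.1)
    have hiff : ∀ x : K × K, Γ x ∈ tangentBundle (fset K k m) ↔
        a.eval x.1 = 0 ∧ c.eval x.1 + x.2 * b.eval x.1 = 0 := by
      rintro ⟨s, t⟩
      rw [hmem]
      have e0 : Γ (s, t) i0 = A.eval s := by simp [Γ, A, hw0]; ring
      have e1 : Γ (s, t) i1 = B.eval s := by simp [Γ, B, hw1]; ring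
      rw [e0, e1]
      apply and_congr
      · simp only [a, Polynomial.eval_sub, Polynomial.eval_add, Polynomial.eval_pow,
          Polynomial.eval_one, sub_eq_zero]
      · simp only [Γ, b, c, Polynomial.eval_add, Polynomial.eval_mul, Polynomial.eval_pow,
          Polynomial.eval_C, Polynomial.eval_X, Pi.add_apply, Pi.smul_apply, smul_eq_mul]
        constructor
        · intro h; linear_combination h
        · intro h; linear_combination h
    have hset : tangentBundle (fset K k m) ∩ (L : Set (Fin ((k + 2) + (k + 2)) → K)) =
        Γ '' {x : K × K | a.eval x.1 = 0 ∧ c.eval x.1 + x.2 * b.eval x.1 = 0} := by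
      ext z
      constructor
      · rintro ⟨hz, hzL⟩
        have h1 : z - p ∈ L.direction := AffineSubspace.vsub_mem_direction hzL hpL
        have h2 : (⟨z - p, h1⟩ : L.direction) ∈ Submodule.span K
            (Set.range ![(⟨w, hwL⟩ : L.direction), ⟨v, hvL⟩]) := by
          rw [hspan]; trivial
        rw [Matrix.range_cons_cons_empty, Submodule.mem_span_pair] at h2
        obtain ⟨t, s, hst⟩ := h2
        have h3 : t • w + s • v = z - p := congrArg Subtype.val hst
        have h4 : Γ (s, t) = z := by
          simp only [Γ]
          rw [add_comm (s • v), h3]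
          simp
        refine ⟨(s, t), ?_, h4⟩
        rw [← h4] at hz
        exact (hiff _).1 hz
      · rintro ⟨x, hx, rfl⟩
        refine ⟨(hiff x).2 hx, ?_⟩
        exact AffineSubspace.vadd_mem_of_mem_direction
          (L.direction.add_mem (L.direction.smul_mem _ hvL) (L.direction.smul_mem _ hwL)) hpL
    rw [hset] at hfin ⊢
    rw [Set.ncard_image_of_injective _ hΓinj]
    refine (strip_bound a b c hdeg (hfin.of_finite_image hΓinj.injOn)).trans ?_
    exact Nat.le_self_pow (by norm_num) m

/-- A plane meeting the tangent bundle in `m ^ 2` points. -/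
def plane (K : Type) [Field K] (k : ℕ) : (K × K) →ₗ[K] (Fin ((k + 2) + (k + 2)) → K) where
  toFun q j := if j.1 = 0 then q.1 else if j.1 = 1 then q.2 else
    if j.1 = k + 2 then q.1 else if j.1 = k + 3 then - q.2 else 0
  map_add' q q' := by
    funext j
    simp only [Pi.add_apply, Prod.fst_add, Prod.snd_add]
    split_ifs <;> ring
  map_smul' c q := by
    funext j
    simp only [Pi.smul_apply, Prod.smul_fst, Prod.smul_snd, RingHom.id_apply, smul_eq_mul]
    split_ifs <;> ring

lemma geomDegree_tb (K : Type) [Field K] [IsAlgClosed K] [CharZero K] (k m : ℕ) (hm : 0 < m) :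
    geomDegree (tangentBundle (fset K k m)) = m ^ 2 := by
  apply geomDegree_eq _ (m ^ 2) 2 (by rw [varDim_tb K k m hm]; omega)
  · intro L hL hfin
    exact tb_bound K k m hm L hL hfin
  have hinj : Function.Injective (plane K k) := by
    intro q q' h
    have h0 := congrFun h ⟨0, by omega⟩
    have h1 := congrFun h ⟨1, by omega⟩
    exact Prod.ext (by simpa [plane] using h0) (by simpa [plane, -Fin.mk_one] using h1)
  refine ⟨(LinearMap.range (plane K k)).toAffineSubspace, ?_, ?_⟩
  · rw [Submodule.toAffineSubspace_direction, LinearMap.finrank_range_of_inj hinj]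
    simp
  have hset : tangentBundle (fset K k m) ∩
      ((LinearMap.range (plane K k)).toAffineSubspace : Set (Fin ((k + 2) + (k + 2)) → K)) =
      plane K k '' ({x : K | x ^ m = 2⁻¹} ×ˢ {x : K | x ^ m = 2⁻¹}) := by
    have hiff : ∀ q : K × K, plane K k q ∈ tangentBundle (fset K k m) ↔
        q.1 ^ m = 2⁻¹ ∧ q.2 ^ m = 2⁻¹ := by
      intro q
      rw [mem_tb hm]
      have e0 : plane K k q ⟨0, by omega⟩ = q.1 := by simp [plane]
      have e1 : plane K k q ⟨1, by omega⟩ = q.2 := by simp [plane, -Fin.mk_one]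
      have e2 : plane K k q ⟨k + 2, by omega⟩ = q.1 := by simp [plane]
      have e3 : plane K k q ⟨k + 3, by omega⟩ = - q.2 := by simp [plane]
      rw [e0, e1, e2, e3]
      obtain ⟨j, rfl⟩ : ∃ j, m = j + 1 := ⟨m - 1, by omega⟩
      simp only [Nat.add_sub_cancel, mul_neg, ← pow_succ]
      have h2 : (2 : K) ≠ 0 := two_ne_zero
      have h22 : (2 : K) * 2⁻¹ = 1 := mul_inv_cancel₀ h2
      constructor
      · rintro ⟨ha, hb⟩
        constructor
        · apply mul_left_cancel₀ h2
          linear_combination ha + hb - h22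
        · apply mul_left_cancel₀ h2
          linear_combination ha - hb - h22
      · rintro ⟨ha, hb⟩
        rw [ha, hb]
        constructor
        · linear_combination h22
        · ring
    ext z
    constructor
    · rintro ⟨hz, hzL⟩
      obtain ⟨q, rfl⟩ : z ∈ LinearMap.range (plane K k) := hzL
      exact ⟨q, (hiff q).1 hz, rfl⟩
    · rintro ⟨q, hq, rfl⟩
      exact ⟨(hiff q).2 hq, LinearMap.mem_range_self _ q⟩
  obtain ⟨h1, h2⟩ := ncard_roots K hm (inv_ne_zero (two_ne_zero (α := K)))
  rw [hset]
  refine ⟨(h2.prod h2).image _, ?_⟩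
  rw [Set.ncard_image_of_injective _ hinj, Set.ncard_prod, h1, pow_two]

end FermatTB

/-- For every `n ≥ 2` and `m ≥ 1` there is a smooth irreducible hypersurface
`V ⊆ A^n` of degree `m` with `deg(TV) = m²`: the bound `deg(TV) ≤ deg(V)²` for
smooth irreducible hypersurfaces is optimal. -/
theorem exists_hypersurface_degree_tangentBundle_eq_sq {K : Type} [Field K]
    [IsAlgClosed K] [CharZero K] {n : ℕ} (hn : 2 ≤ n) (m : ℕ) (hm : 0 < m) :
    ∃ V : Set (Fin n → K), IsIrreducibleVariety V ∧ IsSmoothVariety V ∧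
      varDim V = n - 1 ∧ geomDegree V = m ∧
      geomDegree (tangentBundle V) = m ^ 2 := by
  obtain ⟨k, rfl⟩ : ∃ k, n = k + 2 := ⟨n - 2, by omega⟩
  exact ⟨FermatTB.fset K k m, FermatTB.fset_irr K k m hm, FermatTB.fset_smooth K k m hm,
    by rw [FermatTB.varDim_fset K k m hm]; omega, FermatTB.geomDegree_fset K k m hm,
    FermatTB.geomDegree_tb K k m hm⟩
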